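/- Let k ≥ 2 be an integer, let α ∈ (1 − 1/k, 1), and let φ : ℝ → ℝ be a Schwartz function. Then ∫_{ℝ^k} |φ̂(x₁ + … + x_k)|² · |x₁|^{−α} ⋯ |x_k|^{−α} dx₁ … dx_k < ∞. -/

import Mathlib

open MeasureTheory Filter Set
open scoped ENNReal

/-- The Fourier transform `ĝ(x) = ∫ e^{ixz} g(z) dz`. -/
noncomputable def ft (g : ℝ → ℂ) (x : ℝ) : ℂ :=
  ∫ z : ℝ, Complex.exp (Complex.I * x * z) * g z

/-- The Riesz weight `|x|⁻ᵃ`, valued in `ℝ≥0∞`. -/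
noncomputable def rieszWeight (a x : ℝ) : ℝ≥0∞ := ENNReal.ofReal (|x| ^ (-a))

@[fun_prop]
lemma measurable_rieszWeight (a : ℝ) : Measurable (rieszWeight a) := by
  unfold rieszWeight
  fun_prop

lemma setLIntegral_rieszWeight_lt_top {a : ℝ} (ha : a < 1) :
    ∫⁻ x in Icc (-1 : ℝ) 1, rieszWeight a x < ⊤ := by
  have h : LocallyIntegrable (fun x : ℝ => |x| ^ (-a)) := by
    refine locallyIntegrable_of_norm_le_rpow (C := 1) (α := a) (by simp) (by simpa) ?_
      (Measurable.aestronglyMeasurable (by fun_prop))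
    filter_upwards with x
    rw [Real.norm_of_nonneg (by positivity), Real.norm_eq_abs, one_mul]
  exact (h.integrableOn_isCompact isCompact_Icc).lintegral_lt_top

/-- The function `(1 + |x|)⁻ʳ` has finite integral for `r > 1`. -/
lemma lintegral_one_add_abs_rpow_lt_top {r : ℝ} (hr : 1 < r) :
    ∫⁻ x : ℝ, ENNReal.ofReal ((1 + |x|) ^ (-r)) < ⊤ :=
  (integrable_one_add_norm (E := ℝ) (μ := volume) (r := r) (by simpa using hr)).lintegral_lt_top

/-- The convolution of two Riesz weights is finite at `1`. -/
lemma lintegral_rieszWeight_mul_sub_one_lt_top {a b : ℝ} (ha₀ : 0 < a) (hb₀ : 0 < b) (ha : a < 1)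
    (hb : b < 1) (hab : 1 < a + b) :
    ∫⁻ u, rieszWeight a u * rieszWeight b (1 - u) < ⊤ := by
  have key : ∀ u : ℝ, rieszWeight a u * rieszWeight b (1 - u) ≤
      ENNReal.ofReal (2 ^ b) * (Icc (-1 : ℝ) 1).indicator (rieszWeight a) u +
      ENNReal.ofReal (2 ^ a) * (Icc (-1 : ℝ) 1).indicator (rieszWeight b) (1 - u) +
      ENNReal.ofReal (5 ^ (a + b)) * ENNReal.ofReal ((1 + |u|) ^ (-(a + b))) := by
    intro u
    have half : ∀ c : ℝ, 0 < c → ∀ t : ℝ, 1 / 2 ≤ |t| →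
        rieszWeight c t ≤ ENNReal.ofReal (2 ^ c) := by
      intro c hc t ht
      refine ENNReal.ofReal_le_ofReal ?_
      calc |t| ^ (-c) ≤ (1 / 2 : ℝ) ^ (-c) :=
            Real.rpow_le_rpow_of_nonpos (by norm_num) ht (by linarith)
        _ = 2 ^ c := by
            rw [one_div, Real.inv_rpow (by norm_num), Real.rpow_neg (by norm_num), inv_inv]
    have far : ∀ c : ℝ, 0 < c → ∀ t : ℝ, 1 + |u| ≤ 5 * |t| →
        rieszWeight c t ≤ ENNReal.ofReal (5 ^ c * (1 + |u|) ^ (-c)) := by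
      intro c hc t ht
      refine ENNReal.ofReal_le_ofReal ?_
      have hu : 0 < 1 + |u| := by positivity
      calc |t| ^ (-c) ≤ ((1 + |u|) / 5) ^ (-c) :=
            Real.rpow_le_rpow_of_nonpos (by positivity) (by linarith) (by linarith)
        _ = 5 ^ c * (1 + |u|) ^ (-c) := by
            rw [Real.div_rpow hu.le (by norm_num), Real.rpow_neg (x := 5) (by norm_num)]
            field_simp
    rcases le_or_gt |u| (1 / 2) with h | h
    · have h1 : 1 / 2 ≤ |1 - u| := by
        have := abs_le.1 h
        exact le_trans (by linarith) (le_abs_self _)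
      have hm : u ∈ Icc (-1 : ℝ) 1 := by have := abs_le.1 h; constructor <;> linarith
      refine le_add_right (le_add_right ?_)
      rw [indicator_of_mem hm, mul_comm]
      gcongr
      exact half b hb₀ _ h1
    rcases le_or_gt |1 - u| (1 / 2) with h' | h'
    · have hm : 1 - u ∈ Icc (-1 : ℝ) 1 := by have := abs_le.1 h'; constructor <;> linarith
      refine le_add_right (le_add_left ?_)
      rw [indicator_of_mem hm]
      gcongr
      exact half a ha₀ _ h.le
    · refine le_add_left ?_
      have h2 : |u| ≤ 1 + |1 - u| := by
        have := abs_sub_abs_le_abs_sub u 1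
        rw [abs_sub_comm u 1, abs_one] at this
        linarith
      refine (mul_le_mul' (far a ha₀ u (by linarith)) (far b hb₀ (1 - u) (by linarith))).trans ?_
      rw [← ENNReal.ofReal_mul (by positivity), ← ENNReal.ofReal_mul (by positivity)]
      refine ENNReal.ofReal_le_ofReal (le_of_eq ?_)
      rw [neg_add, Real.rpow_add (by norm_num), Real.rpow_add (by positivity)]
      ring
  refine (lintegral_mono key).trans_lt ?_
  have mi : ∀ c, Measurable ((Icc (-1 : ℝ) 1).indicator (rieszWeight c)) := fun c =>
    (measurable_rieszWeight c).indicator measurableSet_Icc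
  have m1 := mi a
  have m2 : Measurable fun u : ℝ => (Icc (-1 : ℝ) 1).indicator (rieszWeight b) (1 - u) :=
    (mi b).comp (by fun_prop)
  rw [lintegral_add_right _ (by fun_prop), lintegral_add_right _ (by fun_prop),
    lintegral_const_mul _ m1, lintegral_const_mul _ m2, lintegral_const_mul _ (by fun_prop),
    lintegral_sub_left_eq_self (fun u => (Icc (-1 : ℝ) 1).indicator (rieszWeight b) u) 1,
    lintegral_indicator measurableSet_Icc, lintegral_indicator measurableSet_Icc]
  have := setLIntegral_rieszWeight_lt_top ha
  have := setLIntegral_rieszWeight_lt_top hb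
  have := lintegral_one_add_abs_rpow_lt_top hab
  simp only [ENNReal.add_lt_top]
  refine ⟨⟨?_, ?_⟩, ?_⟩ <;> exact ENNReal.mul_lt_top ENNReal.ofReal_lt_top (by assumption)

/-- The convolution of two Riesz weights is a multiple of the Riesz weight of exponent
`a + b - 1`. -/
lemma lintegral_rieszWeight_mul_sub {a b t : ℝ} (ht : t ≠ 0) :
    ∫⁻ x, rieszWeight a x * rieszWeight b (t - x) =
      (∫⁻ u, rieszWeight a u * rieszWeight b (1 - u)) * rieszWeight (a + b - 1) t := by
  have ht' : 0 < |t| := abs_pos.2 ht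
  have hsc : ∀ u : ℝ, rieszWeight a (t * u) * rieszWeight b (t - t * u) =
      ENNReal.ofReal (|t| ^ (-(a + b))) * (rieszWeight a u * rieszWeight b (1 - u)) := by
    intro u
    rw [show t - t * u = t * (1 - u) by ring]
    simp only [rieszWeight, abs_mul]
    rw [Real.mul_rpow ht'.le (abs_nonneg _), Real.mul_rpow ht'.le (abs_nonneg _), neg_add,
      Real.rpow_add ht', ENNReal.ofReal_mul (by positivity), ENNReal.ofReal_mul (by positivity),
      ENNReal.ofReal_mul (by positivity)]
    ring
  conv_lhs => rw [← Real.smul_map_volume_mul_left ht]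
  rw [lintegral_smul_measure, lintegral_map (by fun_prop) (by fun_prop)]
  simp only [hsc]
  rw [lintegral_const_mul _ (by fun_prop), smul_eq_mul, ← mul_assoc,
    ← ENNReal.ofReal_mul ht'.le, mul_comm]
  rw [rieszWeight, neg_sub, sub_eq_add_neg, Real.rpow_add ht', Real.rpow_one]

/-- The product of `n + 1` Riesz weights of exponent `α`, integrated against a function of the sum
of the coordinates, reduces to a one-dimensional integral. -/
lemma lintegral_prod_rieszWeight_le {α : ℝ} (hα₀ : 0 < α) (hα : α < 1) (n : ℕ)
    (hn : 0 < 1 - (n + 1) * (1 - α)) :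
    ∃ C : ℝ≥0∞, C < ⊤ ∧ ∀ G : ℝ → ℝ≥0∞, Measurable G →
      ∫⁻ x : Fin (n + 1) → ℝ, G (∑ i, x i) * ∏ i, rieszWeight α (x i) ≤
        C * ∫⁻ s, G s * rieszWeight (1 - (n + 1) * (1 - α)) s := by
  induction n with
  | zero =>
    refine ⟨1, ENNReal.one_lt_top, fun G hG => ?_⟩
    have := (volume_preserving_funUnique (Fin 1) ℝ).lintegral_map_equiv
      (fun s => G s * rieszWeight α s)
    simp at this ⊢
    exact this.symm.le
  | succ n ih =>
    push_cast at hn ⊢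
    have hn' : 0 < 1 - ((n : ℝ) + 1) * (1 - α) := by linarith
    obtain ⟨C, hC, h⟩ := ih hn'
    set b := 1 - ((n : ℝ) + 1) * (1 - α) with hb
    have hb₁ : b < 1 := by
      have : 0 < ((n : ℝ) + 1) * (1 - α) := mul_pos (by positivity) (by linarith)
      linarith
    have hexp : 1 - ((n : ℝ) + 1 + 1) * (1 - α) = α + b - 1 := by rw [hb]; ring
    rw [hexp] at hn ⊢
    have hI := lintegral_rieszWeight_mul_sub_one_lt_top hα₀ hn' hα hb₁ (by linarith)
    refine ⟨C * ∫⁻ u, rieszWeight α u * rieszWeight b (1 - u), ENNReal.mul_lt_top hC hI,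
      fun G hG => ?_⟩
    calc ∫⁻ x : Fin (n + 1 + 1) → ℝ, G (∑ i, x i) * ∏ i, rieszWeight α (x i)
        = ∫⁻ p : ℝ × (Fin (n + 1) → ℝ), G (p.1 + ∑ i, p.2 i) *
            (rieszWeight α p.1 * ∏ i, rieszWeight α (p.2 i)) := by
          rw [(volume_preserving_piFinSuccAbove
            (fun _ : Fin (n + 1 + 1) => ℝ) 0).lintegral_map_equiv]
          simp only [Fin.sum_univ_succ (n := n + 1), Fin.prod_univ_succ (n := n + 1)]
          rfl
      _ = ∫⁻ y : ℝ, rieszWeight α y * ∫⁻ x : Fin (n + 1) → ℝ, G (y + ∑ i, x i) *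
            ∏ i, rieszWeight α (x i) := by
          rw [Measure.volume_eq_prod, lintegral_prod _ (by fun_prop)]
          refine lintegral_congr fun y => ?_
          rw [← lintegral_const_mul _ (by fun_prop)]
          refine lintegral_congr fun x => ?_
          ring
      _ ≤ ∫⁻ y : ℝ, rieszWeight α y * (C * ∫⁻ s, G (y + s) * rieszWeight b s) := by
          gcongr with y
          exact h (fun s => G (y + s)) (by fun_prop)
      _ = ∫⁻ y : ℝ, ∫⁻ t, C * (G t * (rieszWeight α y * rieszWeight b (t - y))) := by
          refine lintegral_congr fun y => ?_
          rw [← lintegral_sub_right_eq_self (fun s => G (y + s) * rieszWeight b s) y,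
            ← lintegral_const_mul _ (by fun_prop), ← lintegral_const_mul _ (by fun_prop)]
          refine lintegral_congr fun t => ?_
          rw [add_sub_cancel]
          ring
      _ = ∫⁻ t, C * (G t * ∫⁻ y, rieszWeight α y * rieszWeight b (t - y)) := by
          rw [lintegral_lintegral_swap (by fun_prop)]
          refine lintegral_congr fun t => ?_
          rw [lintegral_const_mul _ (by fun_prop), lintegral_const_mul _ (by fun_prop)]
      _ = ∫⁻ t, C * (∫⁻ u, rieszWeight α u * rieszWeight b (1 - u)) *
            (G t * rieszWeight (α + b - 1) t) := by
          refine lintegral_congr_ae ?_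
          filter_upwards [Measure.ae_ne volume (0 : ℝ)] with t ht
          rw [lintegral_rieszWeight_mul_sub ht]
          ring
      _ ≤ _ := by rw [lintegral_const_mul _ (by fun_prop)]

/-- The Fourier transform of a real Schwartz function is a dilate of a complex Schwartz function. -/
lemma exists_schwartzMap_ft_eq (φ : SchwartzMap ℝ ℝ) :
    ∃ ψ : SchwartzMap ℝ ℂ, ∀ x, ft (fun z => (φ z : ℂ)) x = ψ (-x / (2 * Real.pi)) := by
  refine ⟨FourierTransform.fourier (SchwartzMap.postcompCLM (𝕜 := ℝ) Complex.ofRealCLM φ),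
    fun x => ?_⟩
  rw [SchwartzMap.fourier_coe, Real.fourier_real_eq_integral_exp_smul, ft]
  refine integral_congr_ae (ae_of_all _ fun z => ?_)
  simp only [SchwartzMap.postcompCLM_apply, Complex.ofRealCLM_apply, smul_eq_mul]
  congr 2
  have := Real.pi_ne_zero
  push_cast
  field_simp

/-- The squared modulus of the Fourier transform of a Schwartz function decays quadratically. -/
lemma exists_norm_ft_sq_le (φ : SchwartzMap ℝ ℝ) :
    ∃ C : ℝ, ∀ x, ‖ft (fun z => (φ z : ℂ)) x‖ ^ 2 ≤ C * (1 + |x|) ^ (-2 : ℝ) := by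
  obtain ⟨ψ, hψ⟩ := exists_schwartzMap_ft_eq φ
  obtain ⟨A, hA⟩ := ψ.decay 0 0
  obtain ⟨B, hB⟩ := ψ.decay 1 0
  refine ⟨(A + 2 * Real.pi * B) ^ 2, fun x => ?_⟩
  have h0 := hA.2 (-x / (2 * Real.pi))
  have h1 := hB.2 (-x / (2 * Real.pi))
  simp only [norm_iteratedFDeriv_zero, pow_zero, one_mul, pow_one, ← hψ] at h0 h1
  have hp := Real.pi_pos
  rw [Real.norm_eq_abs, abs_div, abs_neg, abs_of_pos (by positivity : 0 < 2 * Real.pi),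
    div_mul_eq_mul_div, div_le_iff₀ (by positivity)] at h1
  have hx : 0 < 1 + |x| := by positivity
  rw [Real.rpow_neg hx.le, Real.rpow_two, ← div_eq_mul_inv, le_div_iff₀ (by positivity),
    ← mul_pow]
  gcongr
  linarith

/-- A function with quadratic decay is integrable against any Riesz weight of exponent in
`(0, 1)`. -/
lemma lintegral_mul_rieszWeight_lt_top {G : ℝ → ℝ} {C c : ℝ} (hc₀ : 0 < c) (hc : c < 1)
    (hG : ∀ x, G x ≤ C * (1 + |x|) ^ (-2 : ℝ)) (hC : 0 ≤ C) :
    ∫⁻ s, ENNReal.ofReal (G s) * rieszWeight c s < ⊤ := by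
  have key : ∀ s, ENNReal.ofReal (G s) * rieszWeight c s ≤ ENNReal.ofReal C *
      ((Icc (-1 : ℝ) 1).indicator (rieszWeight c) s + ENNReal.ofReal ((1 + |s|) ^ (-2 : ℝ))) := by
    intro s
    have h1 : ENNReal.ofReal (G s) ≤ ENNReal.ofReal C * ENNReal.ofReal ((1 + |s|) ^ (-2 : ℝ)) := by
      rw [← ENNReal.ofReal_mul hC]
      exact ENNReal.ofReal_le_ofReal (hG s)
    refine (mul_le_mul_left h1 _).trans ?_
    rw [mul_assoc]
    gcongr
    by_cases hs : s ∈ Icc (-1 : ℝ) 1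
    · rw [indicator_of_mem hs]
      refine le_add_right (mul_le_of_le_one_left' ?_)
      rw [ENNReal.ofReal_le_one]
      exact Real.rpow_le_one_of_one_le_of_nonpos (by simp) (by norm_num)
    · refine le_add_left (mul_le_of_le_one_right' ?_)
      rw [rieszWeight, ENNReal.ofReal_le_one]
      refine Real.rpow_le_one_of_one_le_of_nonpos ?_ (by linarith)
      by_contra! h
      exact hs (abs_le.1 h.le)
  refine (lintegral_mono key).trans_lt ?_
  rw [lintegral_const_mul' _ _ ENNReal.ofReal_ne_top, lintegral_add_right _ (by fun_prop),
    lintegral_indicator measurableSet_Icc]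
  exact ENNReal.mul_lt_top ENNReal.ofReal_lt_top (ENNReal.add_lt_top.2
    ⟨setLIntegral_rieszWeight_lt_top hc, lintegral_one_add_abs_rpow_lt_top (by norm_num)⟩)

theorem stmt5 (k : ℕ) (hk : 2 ≤ k) (α : ℝ) (hα : α ∈ Set.Ioo (1 - 1 / (k : ℝ)) 1)
    (φ : SchwartzMap ℝ ℝ) :
    ∫⁻ x : Fin k → ℝ,
      ENNReal.ofReal
        (‖ft (fun z => (φ z : ℂ)) (∑ i, x i)‖ ^ 2 * ∏ i, |x i| ^ (-α)) < ⊤ := by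
  obtain ⟨n, rfl⟩ : ∃ n, k = n + 1 := ⟨k - 1, by omega⟩
  obtain ⟨hα₁, hα₂⟩ := hα
  have hk₀ : (0 : ℝ) < n + 1 := by positivity
  push_cast at hα₁
  have hc₀ : 0 < 1 - ((n : ℝ) + 1) * (1 - α) := by
    have : 1 - α < 1 / ((n : ℝ) + 1) := by linarith
    rw [lt_div_iff₀ hk₀] at this
    linarith
  have hc₁ : 1 - ((n : ℝ) + 1) * (1 - α) < 1 := by
    have : 0 < ((n : ℝ) + 1) * (1 - α) := mul_pos hk₀ (by linarith)
    linarith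
  have hα₀ : 0 < α := by
    have : 1 / ((n : ℝ) + 1) ≤ 1 := by
      rw [div_le_one hk₀]
      simp
    linarith
  obtain ⟨C, hC, h⟩ := lintegral_prod_rieszWeight_le hα₀ hα₂ n hc₀
  obtain ⟨D, hD⟩ := exists_norm_ft_sq_le φ
  have hD₀ : 0 ≤ D := by simpa using (sq_nonneg _).trans (hD 0)
  have hm : Measurable fun s => ENNReal.ofReal (‖ft (fun z => (φ z : ℂ)) s‖ ^ 2) := by
    obtain ⟨ψ, hψ⟩ := exists_schwartzMap_ft_eq φ
    have := ψ.continuous.measurable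
    simp only [hψ]
    fun_prop
  refine lt_of_eq_of_lt (lintegral_congr fun x => ?_) ((h _ hm).trans_lt (ENNReal.mul_lt_top hC
    (lintegral_mul_rieszWeight_lt_top hc₀ hc₁ hD hD₀)))
  rw [ENNReal.ofReal_mul (by positivity), ENNReal.ofReal_prod_of_nonneg fun i _ => by positivity]
  rfl
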